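/- Let (W,U) be a graphon game and f a strategy profile. The following are equivalent: (1) f is a Nash equilibrium of (W,U); (2) there exist sequences {G_n} of network games, {s_n} of strategy profiles and {ε_n} of nonnegative reals such that s_n is an ε_n-Nash equilibrium of G_n for every n, {G_n} converges to (W,U), f_{s_n} → f a.e., and ε_n → 0; (3) for every sequence {G_n} of network games converging to (W,U), there exist sequences {s_n} of strategy profiles and {ε_n} of nonnegative reals such that s_n is an ε_n-Nash equilibrium of G_n for every n, f_{s_n} → f a.e., and ε_n → 0. -/

import Mathlib

open MeasureTheory Set Filter Topology

noncomputable section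

variable {E : Type*} [NormedAddCommGroup E] [NormedSpace ℝ E]

/-- The common strategy set `S`, viewed as a subset of `E` with the weak topology. -/
def weakS (S : Set E) : Set (WeakSpace ℝ E) := toWeakSpace ℝ E '' S

/-- The Banach space `C` of real-valued functions on `S × S` that are continuous for the
weak topology of `S`, with the supremum norm. (Since `S` is weakly compact, these are
exactly the bounded continuous functions on `S × S` with the weak topology.) -/
abbrev CGame (S : Set E) := BoundedContinuousFunction (↥(weakS S) × ↥(weakS S)) ℝ

/-- An element of `S`, as a point of `S` with the weak topology. -/
def memWeakS {S : Set E} {a : E} (ha : a ∈ S) : ↥(weakS S) :=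
  ⟨toWeakSpace ℝ E a, a, ha, rfl⟩

/-- The agent space `(0,1]` with Lebesgue measure. -/
def μ01 : Measure ℝ := volume.restrict (Set.Ioc (0 : ℝ) 1)

/-- Lebesgue measure on `(0,1]²`. -/
def μ01sq : Measure (ℝ × ℝ) := volume.restrict ((Set.Ioc (0 : ℝ) 1) ×ˢ (Set.Ioc (0 : ℝ) 1))

/-- The local aggregate `∫ W(t,s) f(s) dμ(s)` of a strategy profile `f`. -/
def agg (W : ℝ → ℝ → ℝ) (f : ℝ → E) (t : ℝ) : E := ∫ s, W t s • f s ∂μ01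

/-- `(W, U)` is a graphon game: `W` is a graphon on `(0,1]` and `U` is a measurable map
from `(0,1]` to the closed unit ball `C₀` of `C`. -/
def IsGraphonGame (S : Set E) (W : ℝ → ℝ → ℝ) (U : ℝ → CGame S) : Prop :=
  Measurable (Function.uncurry W) ∧
  (∀ t ∈ Set.Ioc (0 : ℝ) 1, ∀ s ∈ Set.Ioc (0 : ℝ) 1, W t s ∈ Set.Icc (0 : ℝ) 1) ∧
  StronglyMeasurable U ∧ (∀ t, ‖U t‖ ≤ 1)

/-- A strategy profile of a graphon game: a measurable function from agents to `S`. -/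
def IsProfile (S : Set E) (f : ℝ → E) : Prop :=
  StronglyMeasurable f ∧ ∀ t, f t ∈ S

/-- `f` is a Nash equilibrium of the graphon game `(W, U)`: for a.e. agent `t`, `f t`
maximizes `a ↦ U t (a, agg W f t)` over `S`. (The membership facts `f t ∈ S` and
`agg W f t ∈ S`, which always hold for strategy profiles since `S` is closed convex and
contains `0`, are quantified universally so that the utility can be evaluated.) -/
def IsNashEq (S : Set E) (W : ℝ → ℝ → ℝ) (U : ℝ → CGame S) (f : ℝ → E) : Prop :=
  ∀ᵐ t ∂μ01, ∀ (hft : f t ∈ S) (hag : agg W f t ∈ S), ∀ a, ∀ ha : a ∈ S,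
    U t (memWeakS ha, memWeakS hag) ≤ U t (memWeakS hft, memWeakS hag)

/-- `f` is an `ε`-Nash equilibrium of the graphon game `(W, U)`: the set of agents whose
strategy is `ε`-optimal has measure at least `1 - ε`. -/
def IsEpsNashEq (S : Set E) (W : ℝ → ℝ → ℝ) (U : ℝ → CGame S) (f : ℝ → E) (ε : ℝ) : Prop :=
  ENNReal.ofReal (1 - ε) ≤
    μ01 {t : ℝ | ∀ (hft : f t ∈ S) (hag : agg W f t ∈ S), ∀ a, ∀ ha : a ∈ S,
      U t (memWeakS ha, memWeakS hag) - ε ≤ U t (memWeakS hft, memWeakS hag)}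

/-- A network game with `m` players, common strategy set `S`, adjacency matrix `A` with
entries in `[0,1]` and utility functions `v i` in the unit ball `C₀` of `C`. -/
def IsNetworkGame (S : Set E) (m : ℕ) (A : Fin m → Fin m → ℝ) (v : Fin m → CGame S) : Prop :=
  0 < m ∧ (∀ i j, A i j ∈ Set.Icc (0 : ℝ) 1) ∧ (∀ i, ‖v i‖ ≤ 1)

/-- The local aggregate `m⁻¹ Σ_j A i j • s j` of player `i` in a network game. -/
def netAgg (m : ℕ) (A : Fin m → Fin m → ℝ) (s : Fin m → E) (i : Fin m) : E :=
  (m : ℝ)⁻¹ • ∑ j, A i j • s j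

/-- `s` is an `ε`-Nash equilibrium of the network game `(m, A, v)`: the proportion of
players whose strategy is `ε`-optimal is at least `1 - ε`. -/
def IsNetEpsNashEq (S : Set E) (m : ℕ) (A : Fin m → Fin m → ℝ) (v : Fin m → CGame S)
    (s : Fin m → E) (ε : ℝ) : Prop :=
  1 - ε ≤ (({i : Fin m | ∀ (hsi : s i ∈ S) (hag : netAgg m A s i ∈ S), ∀ a, ∀ ha : a ∈ S,
      v i (memWeakS ha, memWeakS hag) - ε ≤ v i (memWeakS hsi, memWeakS hag)}.ncard : ℝ)) / m

/-- The `m`-step function on `(0,1]` determined by the values `g i` on the intervals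
`(i/m, (i+1)/m]`, with default value `x₀` outside `(0,1]`. -/
def stepOf {X : Type*} (m : ℕ) (g : Fin m → X) (x₀ : X) (t : ℝ) : X :=
  if h : ∃ i : Fin m, t ∈ Set.Ioc ((i : ℝ) / m) (((i : ℝ) + 1) / m) then g h.choose else x₀

/-- The `m`-step graphon `W_A` associated with the adjacency matrix `A`. -/
def stepGraphonOf (m : ℕ) (A : Fin m → Fin m → ℝ) : ℝ → ℝ → ℝ :=
  fun t s => stepOf m (fun i => stepOf m (fun j => A i j) 0 s) 0 t

/-- The `m`-step utility profile `U_v` associated with the utilities `v`. -/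
def stepUtilOf {S : Set E} (m : ℕ) (v : Fin m → CGame S) : ℝ → CGame S := stepOf m v 0

/-- The `m`-step strategy profile `f_s` associated with the strategies `s`. -/
def stepProfileOf (m : ℕ) (s : Fin m → E) : ℝ → E := stepOf m s 0

/-- A sequence of network games `(m n, A n, v n)` converges to the graphon game `(W, U)`:
`W_{A_n} → W` a.e. on `(0,1]²`, `U_{v_n}(t) → U(t)` in the norm of `C` for a.e. `t`, and
the number of players tends to infinity. -/
def NetGamesTendsto (S : Set E) (m : ℕ → ℕ) (A : ∀ n, Fin (m n) → Fin (m n) → ℝ)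
    (v : ∀ n, Fin (m n) → CGame S) (W : ℝ → ℝ → ℝ) (U : ℝ → CGame S) : Prop :=
  (∀ᵐ p ∂μ01sq, Tendsto (fun n => stepGraphonOf (m n) (A n) p.1 p.2) atTop (𝓝 (W p.1 p.2))) ∧
  (∀ᵐ t ∂μ01, Tendsto (fun n => stepUtilOf (m n) (v n) t) atTop (𝓝 (U t))) ∧
  Tendsto m atTop atTop

end

section Topology

variable {E : Type*} [NormedAddCommGroup E] [NormedSpace ℝ E] {S : Set E}

theorem isClosed_of_isCompact_weakS (hS : IsCompact (weakS S)) : IsClosed S := by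
  have h := hS.isClosed.preimage (toWeakSpaceCLM ℝ E).continuous
  have : (toWeakSpaceCLM ℝ E) ⁻¹' weakS S = S := by
    ext x
    simp [weakS]
  rwa [this] at h

theorem exists_norm_le_of_isCompact_weakS (hS : IsCompact (weakS S)) :
    ∃ M, ∀ x ∈ S, ‖x‖ ≤ M := by
  obtain ⟨M, hM⟩ := banach_steinhaus
    (g := fun x : S => NormedSpace.inclusionInDoubleDual ℝ E x) (fun φ => by
      have hφ : Continuous fun x : WeakSpace ℝ E => φ ((toWeakSpace ℝ E).symm x) :=
        WeakBilin.eval_continuous (topDualPairing ℝ E).flip φ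
      obtain ⟨C, hC⟩ := (hS.image hφ).isBounded.exists_norm_le
      refine ⟨C, fun x => hC _ ⟨toWeakSpace ℝ E x, ⟨x, x.2, rfl⟩, by simp⟩⟩)
  refine ⟨M, fun x hx => ?_⟩
  rw [← (NormedSpace.inclusionInDoubleDualLi (E := E) ℝ).norm_map x]
  exact hM ⟨x, hx⟩

theorem memWeakS_tendsto {a : ℕ → E} {b : E} (ha : ∀ n, a n ∈ S) (hb : b ∈ S)
    (h : Tendsto a atTop (𝓝 b)) :
    Tendsto (fun n => memWeakS (ha n)) atTop (𝓝 (memWeakS hb)) :=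
  tendsto_subtype_rng.2 (((toWeakSpaceCLM ℝ E).continuous.tendsto b).comp h)

/-- The largest gain that a player with utility `u` facing the aggregate `b` can obtain by
deviating from the strategy `a`. -/
noncomputable def regret (u : CGame S) (a b : ↥(weakS S)) : ℝ :=
  sSup ((fun a' => u (a', b)) '' univ) - u (a, b)

theorem bddAbove_image_utility (u : CGame S) (b : ↥(weakS S)) :
    BddAbove ((fun a' => u (a', b)) '' univ) := by
  refine ⟨‖u‖, ?_⟩
  rintro _ ⟨a', -, rfl⟩
  exact (le_abs_self _).trans (u.norm_coe_le_norm _)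

theorem regret_nonneg (u : CGame S) (a b : ↥(weakS S)) : 0 ≤ regret u a b :=
  sub_nonneg.2 (le_csSup (bddAbove_image_utility u b) ⟨a, mem_univ _, rfl⟩)

theorem regret_le_iff (u : CGame S) (a b : ↥(weakS S)) (ε : ℝ) :
    regret u a b ≤ ε ↔ ∀ a', u (a', b) - ε ≤ u (a, b) := by
  rw [regret, sub_le_iff_le_add, csSup_le_iff (bddAbove_image_utility u b) ⟨_, a, mem_univ _, rfl⟩]
  simp only [image_univ, forall_mem_range, sub_le_iff_le_add, add_comm ε]

theorem regret_le_two {u : CGame S} (hu : ‖u‖ ≤ 1) (a b : ↥(weakS S)) : regret u a b ≤ 2 := by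
  rw [regret_le_iff]
  intro a'
  have h₁ := abs_le.1 ((u.norm_coe_le_norm (a', b)).trans hu)
  have h₂ := abs_le.1 ((u.norm_coe_le_norm (a, b)).trans hu)
  linarith [h₁.2, h₂.1]

theorem continuous_regret (hS : IsCompact (weakS S)) :
    Continuous fun p : CGame S × ↥(weakS S) × ↥(weakS S) => regret p.1 p.2.1 p.2.2 := by
  have : CompactSpace ↥(weakS S) := isCompact_iff_compactSpace.1 hS
  unfold regret
  refine Continuous.sub ?_ (by fun_prop)
  refine isCompact_univ.continuous_sSup
    (f := fun (p : CGame S × ↥(weakS S) × ↥(weakS S)) a' => p.1 (a', p.2.2)) ?_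
  simp only [Function.HasUncurry.uncurry, id]
  fun_prop

/-- The regret as a function of points of `E`, with value `0` outside `S`. -/
noncomputable def regretOn (u : CGame S) (a b : E) : ℝ :=
  open Classical in
  if h : a ∈ S ∧ b ∈ S then regret u (memWeakS h.1) (memWeakS h.2) else 0

theorem regretOn_nonneg (u : CGame S) (a b : E) : 0 ≤ regretOn u a b := by
  unfold regretOn
  split_ifs
  exacts [regret_nonneg _ _ _, le_rfl]

theorem regretOn_le_two {u : CGame S} (hu : ‖u‖ ≤ 1) (a b : E) : regretOn u a b ≤ 2 := by
  unfold regretOn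
  split_ifs
  exacts [regret_le_two hu _ _, zero_le_two]

theorem regretOn_le_iff (u : CGame S) (a b : E) {ε : ℝ} (hε : 0 ≤ ε) :
    regretOn u a b ≤ ε ↔ ∀ (ha : a ∈ S) (hb : b ∈ S), ∀ a', ∀ ha' : a' ∈ S,
      u (memWeakS ha', memWeakS hb) - ε ≤ u (memWeakS ha, memWeakS hb) := by
  unfold regretOn
  split_ifs with h
  · rw [regret_le_iff]
    constructor
    · exact fun H _ _ _ _ => H _
    · rintro H ⟨_, a', ha', rfl⟩
      exact H h.1 h.2 a' ha'
  · exact ⟨fun _ ha hb => absurd ⟨ha, hb⟩ h, fun _ => hε⟩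

theorem regretOn_of_mem (u : CGame S) {a b : E} (ha : a ∈ S) (hb : b ∈ S) :
    regretOn u a b = regret u (memWeakS ha) (memWeakS hb) :=
  dif_pos ⟨ha, hb⟩

theorem tendsto_regretOn (hS : IsCompact (weakS S)) {u : ℕ → CGame S} {u₀ : CGame S}
    {a b : ℕ → E} {a₀ b₀ : E} (ha : ∀ n, a n ∈ S) (hb : ∀ n, b n ∈ S) (ha₀ : a₀ ∈ S)
    (hb₀ : b₀ ∈ S) (hu : Tendsto u atTop (𝓝 u₀)) (haa : Tendsto a atTop (𝓝 a₀))
    (hbb : Tendsto b atTop (𝓝 b₀)) :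
    Tendsto (fun n => regretOn (u n) (a n) (b n)) atTop (𝓝 (regretOn u₀ a₀ b₀)) := by
  have h := hu.prodMk_nhds
    ((memWeakS_tendsto ha ha₀ haa).prodMk_nhds (memWeakS_tendsto hb hb₀ hbb))
  rw [regretOn_of_mem u₀ ha₀ hb₀]
  refine (((continuous_regret hS).tendsto
    (u₀, memWeakS ha₀, memWeakS hb₀)).comp h).congr fun n => ?_
  rw [regretOn_of_mem (u n) (ha n) (hb n)]
  rfl

end Topology

section Step

/-- The interval of `(0,1]` that represents player `i` of a network game with `m` players. -/
def cell (m : ℕ) (i : Fin m) : Set ℝ := Ioc ((i : ℝ) / m) (((i : ℝ) + 1) / m)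

theorem mem_cell_iff {m : ℕ} {i : Fin m} {t : ℝ} :
    t ∈ cell m i ↔ (i : ℝ) < t * m ∧ t * m ≤ i + 1 := by
  have : (0 : ℝ) < m := by exact_mod_cast i.pos
  rw [cell, mem_Ioc, div_lt_iff₀ this, le_div_iff₀ this]

theorem cell_unique {m : ℕ} {i j : Fin m} {t : ℝ} (hi : t ∈ cell m i) (hj : t ∈ cell m j) :
    i = j := by
  rw [mem_cell_iff] at hi hj
  have h₁ : (i : ℝ) < j + 1 := hi.1.trans_le hj.2
  have h₂ : (j : ℝ) < i + 1 := hj.1.trans_le hi.2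
  norm_cast at h₁ h₂
  omega

theorem cell_subset {m : ℕ} (i : Fin m) : cell m i ⊆ Ioc 0 1 := by
  have hm : (0 : ℝ) < m := by exact_mod_cast i.pos
  refine Ioc_subset_Ioc (by positivity) ?_
  rw [div_le_one hm]
  exact_mod_cast i.2

theorem exists_mem_cell {m : ℕ} (hm : 0 < m) {t : ℝ} (ht : t ∈ Ioc (0 : ℝ) 1) :
    ∃ i : Fin m, t ∈ cell m i := by
  have hm' : (0 : ℝ) < m := by exact_mod_cast hm
  have hpos : 0 < ⌈t * m⌉₊ := Nat.ceil_pos.2 (mul_pos ht.1 hm')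
  have hle : ⌈t * m⌉₊ ≤ m := Nat.ceil_le.2 (mul_le_of_le_one_left hm'.le ht.2)
  refine ⟨⟨⌈t * m⌉₊ - 1, by omega⟩, mem_cell_iff.2 ⟨?_, ?_⟩⟩
  · exact Nat.lt_ceil.1 (by simpa using hpos)
  · push_cast [Nat.cast_sub (Nat.one_le_iff_ne_zero.2 hpos.ne')]
    linarith [Nat.le_ceil (t * m)]

theorem measurableSet_cell {m : ℕ} (i : Fin m) : MeasurableSet (cell m i) := measurableSet_Ioc

theorem volume_cell {m : ℕ} (i : Fin m) : volume (cell m i) = ENNReal.ofReal (m : ℝ)⁻¹ := by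
  rw [cell, Real.volume_Ioc]
  congr 1
  ring

theorem μ01_real_cell {m : ℕ} (i : Fin m) : μ01.real (cell m i) = (m : ℝ)⁻¹ := by
  rw [measureReal_def, μ01, Measure.restrict_apply (measurableSet_cell i),
    inter_eq_left.2 (cell_subset i), volume_cell, ENNReal.toReal_ofReal (by positivity)]

instance : IsProbabilityMeasure μ01 := ⟨by simp [μ01]⟩

variable {X : Type*} {m : ℕ}

theorem stepOf_of_mem {g : Fin m → X} {x₀ : X} {t : ℝ} {i : Fin m} (h : t ∈ cell m i) :
    stepOf m g x₀ t = g i := by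
  have H : ∃ i : Fin m, t ∈ Ioc ((i : ℝ) / m) (((i : ℝ) + 1) / m) := ⟨i, h⟩
  rw [stepOf, dif_pos H, cell_unique H.choose_spec h]

variable {F : Type*} [NormedAddCommGroup F]

theorem stepOf_eq_sum (g : Fin m → F) :
    stepOf m g 0 = fun t => ∑ i, (cell m i).indicator (fun _ => g i) t := by
  ext t
  by_cases h : ∃ i : Fin m, t ∈ cell m i
  · obtain ⟨i, hi⟩ := h
    rw [stepOf_of_mem hi, Finset.sum_eq_single i, indicator_of_mem hi]
    · exact fun j _ hj => indicator_of_notMem (fun h => hj (cell_unique h hi)) _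
    · simp
  · rw [stepOf, dif_neg (by exact h), Finset.sum_eq_zero]
    exact fun i _ => indicator_of_notMem (fun hi => h ⟨i, hi⟩) _

theorem stronglyMeasurable_stepOf (g : Fin m → F) : StronglyMeasurable (stepOf m g 0) := by
  rw [stepOf_eq_sum]
  exact Finset.stronglyMeasurable_fun_sum _ fun i _ =>
    stronglyMeasurable_const.indicator (measurableSet_cell i)

theorem integral_stepOf [NormedSpace ℝ F] [CompleteSpace F] (g : Fin m → F) :
    ∫ t, stepOf m g 0 t ∂μ01 = (m : ℝ)⁻¹ • ∑ i, g i := by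
  rw [stepOf_eq_sum, integral_finsetSum]
  · simp_rw [integral_indicator_const _ (measurableSet_cell _), μ01_real_cell, Finset.smul_sum]
  · exact fun i _ => (integrable_const _).indicator (measurableSet_cell i)

end Step

section Markov

variable {m : ℕ} {r : Fin m → ℝ}

theorem ncard_le_add_card_lt (r : Fin m → ℝ) (δ : ℝ) :
    ({i | r i ≤ δ}.ncard : ℝ) + (Finset.univ.filter fun i => δ < r i).card = m := by
  have h₁ : {i | r i ≤ δ}.ncard = (Finset.univ.filter fun i => r i ≤ δ).card := by
    rw [← ncard_coe_finset]
    congr 1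
    ext
    simp
  have h₂ := Finset.card_filter_add_card_filter_not (s := (Finset.univ : Finset (Fin m)))
    (fun i => r i ≤ δ)
  simp only [not_le, Finset.card_univ, Fintype.card_fin] at h₂
  rw [h₁]
  exact_mod_cast h₂

theorem one_sub_sqrt_average_le (hm : 0 < m) (hr : ∀ i, 0 ≤ r i) :
    1 - √((m : ℝ)⁻¹ * ∑ i, r i) ≤
      ({i | r i ≤ √((m : ℝ)⁻¹ * ∑ i, r i)}.ncard : ℝ) / m := by
  have hm' : (0 : ℝ) < m := by exact_mod_cast hm
  have hsum : 0 ≤ ∑ i, r i := Finset.sum_nonneg fun i _ => hr i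
  have hc : 0 ≤ (m : ℝ)⁻¹ * ∑ i, r i := by positivity
  set δ := √((m : ℝ)⁻¹ * ∑ i, r i) with hδ
  have hδ0 : 0 ≤ δ := Real.sqrt_nonneg _
  have hδ2 : δ * δ * m = ∑ i, r i := by
    rw [hδ, Real.mul_self_sqrt hc]
    field_simp
  have hcard := ncard_le_add_card_lt r δ
  rw [le_div_iff₀ hm']
  suffices h : ((Finset.univ.filter fun i => δ < r i).card : ℝ) ≤ δ * m by linarith
  rcases hδ0.eq_or_lt with h0 | h0
  · rw [← h0] at hδ2 ⊢
    have hall := (Finset.sum_eq_zero_iff_of_nonneg fun i _ => hr i).1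
      (show ∑ i, r i = 0 by simpa using hδ2.symm)
    rw [Finset.filter_false_of_mem]
    · simp
    · exact fun i hi => by simp [hall i hi]
  · have hle : (Finset.univ.filter fun i => δ < r i).card • δ ≤ ∑ i, r i :=
      (Finset.card_nsmul_le_sum _ _ _ fun i hi => (Finset.mem_filter.1 hi).2.le).trans
        (Finset.sum_le_sum_of_subset_of_nonneg (Finset.filter_subset _ _) fun i _ _ => hr i)
    rw [nsmul_eq_mul, ← hδ2] at hle
    exact le_of_mul_le_mul_right (by linarith) h0

theorem average_le_of_one_sub_le (hm : 0 < m) {C ε : ℝ} (hr : ∀ i, r i ≤ C) (hε : 0 ≤ ε)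
    (hC : 0 ≤ C) (h : 1 - ε ≤ ({i | r i ≤ ε}.ncard : ℝ) / m) :
    (m : ℝ)⁻¹ * ∑ i, r i ≤ (1 + C) * ε := by
  have hm' : (0 : ℝ) < m := by exact_mod_cast hm
  have hcard := ncard_le_add_card_lt r ε
  rw [le_div_iff₀ hm'] at h
  have hle : ∑ i, r i ≤ ∑ i, (ε + if ε < r i then C else 0) := by
    refine Finset.sum_le_sum fun i _ => ?_
    split_ifs with hi
    · linarith [hr i]
    · linarith
  rw [Finset.sum_add_distrib, ← Finset.sum_filter, Finset.sum_const, Finset.sum_const,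
    Finset.card_univ, Fintype.card_fin, nsmul_eq_mul, nsmul_eq_mul] at hle
  rw [inv_mul_le_iff₀ hm']
  have : ((Finset.univ.filter fun i => ε < r i).card : ℝ) * C ≤ ε * m * C :=
    mul_le_mul_of_nonneg_right (by linarith) hC
  linarith

end Markov

section Games

variable {E : Type*} [NormedAddCommGroup E] [NormedSpace ℝ E] {S : Set E}

theorem netAgg_mem (hS0 : (0 : E) ∈ S) (hSconv : Convex ℝ S) {m : ℕ} {A : Fin m → Fin m → ℝ}
    {s : Fin m → E} (hA : ∀ i j, A i j ∈ Icc (0 : ℝ) 1) (hs : ∀ i, s i ∈ S) (i : Fin m) :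
    netAgg m A s i ∈ S := by
  have hm : (m : ℝ) ≠ 0 := by exact_mod_cast i.pos.ne'
  rw [netAgg, Finset.smul_sum]
  refine hSconv.sum_mem (fun _ _ => by positivity) (by simp [hm]) fun j _ =>
    hSconv.smul_mem_of_zero_mem hS0 (hs j) (hA i j)

theorem stepGraphonOf_of_mem {m : ℕ} (A : Fin m → Fin m → ℝ) {t s : ℝ} {i j : Fin m}
    (hi : t ∈ cell m i) (hj : s ∈ cell m j) : stepGraphonOf m A t s = A i j := by
  rw [stepGraphonOf, stepOf_of_mem hi, stepOf_of_mem hj]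

theorem stepGraphonOf_smul_stepProfileOf {m : ℕ} (A : Fin m → Fin m → ℝ) (s : Fin m → E)
    {t : ℝ} {i : Fin m} (hi : t ∈ cell m i) :
    (fun y => stepGraphonOf m A t y • stepProfileOf m s y) =
      stepOf m (fun j => A i j • s j) 0 := by
  ext y
  by_cases h : ∃ j : Fin m, y ∈ cell m j
  · obtain ⟨j, hj⟩ := h
    rw [stepGraphonOf_of_mem A hi hj, stepProfileOf, stepOf_of_mem hj, stepOf_of_mem hj]
  · rw [stepProfileOf, stepOf, stepOf, dif_neg (by exact h), dif_neg (by exact h), smul_zero]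

theorem agg_step [CompleteSpace E] {m : ℕ} (A : Fin m → Fin m → ℝ) (s : Fin m → E)
    {t : ℝ} {i : Fin m} (hi : t ∈ cell m i) :
    agg (stepGraphonOf m A) (stepProfileOf m s) t = netAgg m A s i := by
  rw [agg, stepGraphonOf_smul_stepProfileOf A s hi, integral_stepOf, netAgg]

theorem ae_mem_Ioc : ∀ᵐ t ∂μ01, t ∈ Ioc (0 : ℝ) 1 := ae_restrict_mem measurableSet_Ioc

theorem agg_mem [CompleteSpace E] (hS0 : (0 : E) ∈ S) (hSconv : Convex ℝ S)
    (hScomp : IsCompact (weakS S)) {W : ℝ → ℝ → ℝ} {U : ℝ → CGame S}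
    (hG : IsGraphonGame S W U) {f : ℝ → E} (hf : IsProfile S f) {t : ℝ} (ht : t ∈ Ioc (0 : ℝ) 1) :
    agg W f t ∈ S := by
  have hmem : ∀ᵐ y ∂μ01, W t y • f y ∈ S := by
    filter_upwards [ae_mem_Ioc] with y hy
    exact hSconv.smul_mem_of_zero_mem hS0 (hf.2 y) (hG.2.1 t ht y hy)
  obtain ⟨M, hM⟩ := exists_norm_le_of_isCompact_weakS hScomp
  refine hSconv.integral_mem (isClosed_of_isCompact_weakS hScomp) hmem ?_
  refine Integrable.of_bound (C := M) ?_ (hmem.mono fun y hy => hM _ hy)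
  exact ((hG.1.of_uncurry_left (x := t)).stronglyMeasurable.smul hf.1).aestronglyMeasurable

theorem ae_tendsto_agg (hS0 : (0 : E) ∈ S) (hSconv : Convex ℝ S) (hScomp : IsCompact (weakS S))
    {W : ℝ → ℝ → ℝ} {U : ℝ → CGame S} {f : ℝ → E} {m : ℕ → ℕ}
    {A : ∀ n, Fin (m n) → Fin (m n) → ℝ} {v : ∀ n, Fin (m n) → CGame S}
    {s : ∀ n, Fin (m n) → E} (hN : ∀ n, IsNetworkGame S (m n) (A n) (v n))
    (hs : ∀ n i, s n i ∈ S) (hlim : NetGamesTendsto S m A v W U)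
    (hsf : ∀ᵐ t ∂μ01, Tendsto (fun n => stepProfileOf (m n) (s n) t) atTop (𝓝 (f t))) :
    ∀ᵐ t ∂μ01, Tendsto (fun n => agg (stepGraphonOf (m n) (A n)) (stepProfileOf (m n) (s n)) t)
      atTop (𝓝 (agg W f t)) := by
  have hW := hlim.1
  rw [μ01sq, Measure.volume_eq_prod, ← Measure.prod_restrict] at hW
  obtain ⟨M, hM⟩ := exists_norm_le_of_isCompact_weakS hScomp
  filter_upwards [Measure.ae_ae_of_ae_prod hW, ae_mem_Ioc] with t hWt ht
  choose i hi using fun n => exists_mem_cell (hN n).1 ht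
  refine tendsto_integral_of_dominated_convergence (fun _ => M) (fun n => ?_)
    (integrable_const M) (fun n => ?_) ?_
  · rw [stepGraphonOf_smul_stepProfileOf _ _ (hi n)]
    exact (stronglyMeasurable_stepOf _).aestronglyMeasurable
  · filter_upwards [ae_mem_Ioc] with y hy
    obtain ⟨j, hj⟩ := exists_mem_cell (hN n).1 hy
    rw [stepGraphonOf_of_mem _ (hi n) hj, stepProfileOf, stepOf_of_mem hj]
    exact hM _ (hSconv.smul_mem_of_zero_mem hS0 (hs n j) ((hN n).2.1 (i n) j))
  · filter_upwards [hWt, hsf] with y hy₁ hy₂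
    exact hy₁.smul hy₂

theorem integrable_regretOn_and_tendsto [CompleteSpace E] (hS0 : (0 : E) ∈ S)
    (hSconv : Convex ℝ S) (hScomp : IsCompact (weakS S)) {W : ℝ → ℝ → ℝ} {U : ℝ → CGame S}
    (hG : IsGraphonGame S W U) {f : ℝ → E} (hf : IsProfile S f) {m : ℕ → ℕ}
    {A : ∀ n, Fin (m n) → Fin (m n) → ℝ} {v : ∀ n, Fin (m n) → CGame S}
    {s : ∀ n, Fin (m n) → E} (hN : ∀ n, IsNetworkGame S (m n) (A n) (v n))
    (hs : ∀ n i, s n i ∈ S) (hlim : NetGamesTendsto S m A v W U)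
    (hsf : ∀ᵐ t ∂μ01, Tendsto (fun n => stepProfileOf (m n) (s n) t) atTop (𝓝 (f t))) :
    Integrable (fun t => regretOn (U t) (f t) (agg W f t)) μ01 ∧
      Tendsto (fun n => ((m n : ℝ))⁻¹ *
          ∑ i, regretOn (v n i) (s n i) (netAgg (m n) (A n) (s n) i)) atTop
        (𝓝 (∫ t, regretOn (U t) (f t) (agg W f t) ∂μ01)) := by
  set r : ∀ n, Fin (m n) → ℝ := fun n i => regretOn (v n i) (s n i) (netAgg (m n) (A n) (s n) i)
  have hr : ∀ᵐ t ∂μ01, Tendsto (fun n => stepOf (m n) (r n) 0 t) atTop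
      (𝓝 (regretOn (U t) (f t) (agg W f t))) := by
    filter_upwards [ae_tendsto_agg hS0 hSconv hScomp hN hs hlim hsf, hsf, hlim.2.1, ae_mem_Ioc]
      with t hagg hft hUt ht
    choose i hi using fun n => exists_mem_cell (hN n).1 ht
    simp only [agg_step _ _ (hi _)] at hagg
    simp only [stepProfileOf, stepUtilOf, stepOf_of_mem (hi _)] at hft hUt ⊢
    exact tendsto_regretOn hScomp (fun n => hs n _)
      (fun n => netAgg_mem hS0 hSconv (hN n).2.1 (hs n) _) (hf.2 t)
      (agg_mem hS0 hSconv hScomp hG hf ht) hUt hft hagg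
  have hmeas : ∀ n, AEStronglyMeasurable (stepOf (m n) (r n) 0) μ01 := fun n =>
    (stronglyMeasurable_stepOf _).aestronglyMeasurable
  refine ⟨Integrable.of_bound (C := 2) (aestronglyMeasurable_of_tendsto_ae atTop hmeas hr)
    (.of_forall fun t => ?_), ?_⟩
  · rw [Real.norm_of_nonneg (regretOn_nonneg _ _ _)]
    exact regretOn_le_two (hG.2.2.2 t) _ _
  · have := tendsto_integral_of_dominated_convergence (fun _ => 2) hmeas (integrable_const 2)
      (fun n => ?_) hr
    · simpa only [integral_stepOf, smul_eq_mul] using this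
    · filter_upwards [ae_mem_Ioc] with t ht
      obtain ⟨i, hi⟩ := exists_mem_cell (hN n).1 ht
      rw [stepOf_of_mem hi, Real.norm_of_nonneg (regretOn_nonneg _ _ _)]
      exact regretOn_le_two ((hN n).2.2 i) _ _

theorem isNashEq_iff_regretOn_ae_eq_zero {W : ℝ → ℝ → ℝ} {U : ℝ → CGame S} {f : ℝ → E} :
    IsNashEq S W U f ↔ (fun t => regretOn (U t) (f t) (agg W f t)) =ᵐ[μ01] 0 := by
  refine eventually_congr (.of_forall fun t => ?_)
  have h := regretOn_le_iff (U t) (f t) (agg W f t) le_rfl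
  simp only [sub_zero] at h
  rw [← h, Pi.zero_apply]
  exact ⟨fun h => h.antisymm (regretOn_nonneg _ _ _), fun h => h.le⟩

theorem isNetEpsNashEq_iff {m : ℕ} {A : Fin m → Fin m → ℝ} {v : Fin m → CGame S}
    {s : Fin m → E} {ε : ℝ} (hε : 0 ≤ ε) :
    IsNetEpsNashEq S m A v s ε ↔
      1 - ε ≤ ({i | regretOn (v i) (s i) (netAgg m A s i) ≤ ε}.ncard : ℝ) / m := by
  simp only [IsNetEpsNashEq, regretOn_le_iff _ _ _ hε]

theorem isNashEq_iff_exists_isNetEpsNashEq [CompleteSpace E] (hS0 : (0 : E) ∈ S)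
    (hSconv : Convex ℝ S) (hScomp : IsCompact (weakS S)) {W : ℝ → ℝ → ℝ} {U : ℝ → CGame S}
    (hG : IsGraphonGame S W U) {f : ℝ → E} (hf : IsProfile S f) {m : ℕ → ℕ}
    {A : ∀ n, Fin (m n) → Fin (m n) → ℝ} {v : ∀ n, Fin (m n) → CGame S}
    {s : ∀ n, Fin (m n) → E} (hN : ∀ n, IsNetworkGame S (m n) (A n) (v n))
    (hs : ∀ n i, s n i ∈ S) (hlim : NetGamesTendsto S m A v W U)
    (hsf : ∀ᵐ t ∂μ01, Tendsto (fun n => stepProfileOf (m n) (s n) t) atTop (𝓝 (f t))) :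
    IsNashEq S W U f ↔ ∃ ε : ℕ → ℝ, (∀ n, 0 ≤ ε n) ∧
      (∀ n, IsNetEpsNashEq S (m n) (A n) (v n) (s n) (ε n)) ∧ Tendsto ε atTop (𝓝 0) := by
  obtain ⟨hint, htend⟩ := integrable_regretOn_and_tendsto hS0 hSconv hScomp hG hf hN hs hlim hsf
  rw [isNashEq_iff_regretOn_ae_eq_zero,
    ← integral_eq_zero_iff_of_nonneg_ae (.of_forall fun t => regretOn_nonneg _ _ _) hint]
  constructor
  · intro h0
    rw [h0] at htend
    refine ⟨_, fun n => Real.sqrt_nonneg _, fun n => ?_, Real.sqrt_zero ▸ htend.sqrt⟩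
    rw [isNetEpsNashEq_iff (Real.sqrt_nonneg _)]
    exact one_sub_sqrt_average_le (hN n).1 fun i => regretOn_nonneg _ _ _
  · rintro ⟨ε, hε, hNash, hε0⟩
    refine tendsto_nhds_unique htend (squeeze_zero (fun n => ?_) (fun n => ?_)
      (by simpa using hε0.const_mul (1 + 2)))
    · exact mul_nonneg (by positivity) (Finset.sum_nonneg fun i _ => regretOn_nonneg _ _ _)
    · exact average_le_of_one_sub_le (hN n).1 (fun i => regretOn_le_two ((hN n).2.2 i) _ _)
        (hε n) zero_le_two ((isNetEpsNashEq_iff (hε n)).1 (hNash n))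

end Games

section Averages

variable {m : ℕ}

theorem closedBall_eq_Icc_div (i : Fin m) :
    Metric.closedBall (((i : ℝ) + 1 / 2) / m) (1 / 2 / m) =
      Icc ((i : ℝ) / m) (((i : ℝ) + 1) / m) := by
  rw [Real.closedBall_eq_Icc]
  congr 1 <;> ring

theorem cell_ae_eq_closedBall (i : Fin m) :
    cell m i =ᵐ[volume] Metric.closedBall (((i : ℝ) + 1 / 2) / m) (1 / 2 / m) := by
  rw [closedBall_eq_Icc_div]
  exact Ioc_ae_eq_Icc

theorem mem_closedBall_of_mem_cell {i : Fin m} {t : ℝ} (ht : t ∈ cell m i) :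
    t ∈ Metric.closedBall (((i : ℝ) + 1 / 2) / m) (1 / 2 / m) := by
  rw [closedBall_eq_Icc_div]
  exact Ioc_subset_Icc_self ht

theorem tendsto_half_div {m : ℕ → ℕ} (hm : Tendsto m atTop atTop) :
    Tendsto (fun n => (1 / 2 / m n : ℝ)) atTop (𝓝[>] 0) := by
  refine tendsto_nhdsWithin_iff.2 ⟨(tendsto_natCast_atTop_atTop.comp hm).const_div_atTop _, ?_⟩
  filter_upwards [hm.eventually_gt_atTop 0] with n hn
  have : (0 : ℝ) < m n := by exact_mod_cast hn
  exact mem_Ioi.2 (by positivity)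

theorem locallyIntegrable_of_norm_le {X F : Type*} [TopologicalSpace X] [MeasurableSpace X]
    {μ : Measure X} [IsLocallyFiniteMeasure μ] [NormedAddCommGroup F] {g : X → F} {M : ℝ}
    (hg : StronglyMeasurable g) (hM : ∀ x, ‖g x‖ ≤ M) : LocallyIntegrable g μ :=
  (locallyIntegrable_const M).mono hg.aestronglyMeasurable
    (.of_forall fun x => (hM x).trans (Real.le_norm_self M))

theorem ae_tendsto_stepOf_average {F : Type*} [NormedAddCommGroup F] [NormedSpace ℝ F]
    [CompleteSpace F] {g : ℝ → F} (hg : LocallyIntegrable g volume) {m : ℕ → ℕ}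
    (hm0 : ∀ n, 0 < m n) (hm : Tendsto m atTop atTop) (x₀ : F) :
    ∀ᵐ t ∂μ01, Tendsto (fun n => stepOf (m n) (fun i => ⨍ y in cell (m n) i, g y) x₀ t) atTop
      (𝓝 (g t)) := by
  filter_upwards [ae_restrict_of_ae (s := Ioc 0 1)
    (IsUnifLocDoublingMeasure.ae_tendsto_average volume hg 1), ae_mem_Ioc] with t h ht
  choose i hi using fun n => exists_mem_cell (hm0 n) ht
  simp only [stepOf_of_mem (hi _), setAverage_congr (cell_ae_eq_closedBall _)]
  refine h _ _ (tendsto_half_div hm) (.of_forall fun n => ?_)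
  rw [one_mul]
  exact mem_closedBall_of_mem_cell (hi n)

theorem ae_tendsto_stepGraphonOf_average {g : ℝ × ℝ → ℝ} (hg : LocallyIntegrable g volume)
    {m : ℕ → ℕ} (hm0 : ∀ n, 0 < m n) (hm : Tendsto m atTop atTop) :
    ∀ᵐ p ∂μ01sq, Tendsto (fun n => stepGraphonOf (m n)
      (fun i j => ⨍ q in cell (m n) i ×ˢ cell (m n) j, g q) p.1 p.2) atTop (𝓝 (g p)) := by
  filter_upwards [ae_restrict_of_ae (s := Ioc (0 : ℝ) 1 ×ˢ Ioc (0 : ℝ) 1)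
    (IsUnifLocDoublingMeasure.ae_tendsto_average volume hg 1),
    ae_restrict_mem (measurableSet_Ioc.prod measurableSet_Ioc)] with p h hp
  choose i hi using fun n => exists_mem_cell (hm0 n) hp.1
  choose j hj using fun n => exists_mem_cell (hm0 n) hp.2
  have hball : ∀ n, ⨍ q in cell (m n) (i n) ×ˢ cell (m n) (j n), g q =
      ⨍ q in Metric.closedBall (((i n : ℝ) + 1 / 2) / m n, ((j n : ℝ) + 1 / 2) / m n)
        (1 / 2 / m n), g q := fun n => by
    rw [← closedBall_prod_same]
    exact setAverage_congr
      (Measure.set_prod_ae_eq (cell_ae_eq_closedBall _) (cell_ae_eq_closedBall _))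
  simp only [stepGraphonOf_of_mem _ (hi _) (hj _), hball]
  refine h _ _ (tendsto_half_div hm) (.of_forall fun n => ?_)
  rw [one_mul, ← closedBall_prod_same]
  exact ⟨mem_closedBall_of_mem_cell (hi n), mem_closedBall_of_mem_cell (hj n)⟩

theorem volume_cell_ne_zero (i : Fin m) : volume (cell m i) ≠ 0 := by
  have : (0 : ℝ) < m := by exact_mod_cast i.pos
  rw [volume_cell]
  exact (ENNReal.ofReal_pos.2 (inv_pos.2 this)).ne'

theorem volume_cell_ne_top (i : Fin m) : volume (cell m i) ≠ ⊤ := by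
  rw [volume_cell]
  exact ENNReal.ofReal_ne_top

theorem average_cell_mem {F : Type*} [NormedAddCommGroup F] [NormedSpace ℝ F]
    [CompleteSpace F] {K : Set F} (hK : Convex ℝ K) (hKc : IsClosed K) {M : ℝ} {g : ℝ → F}
    (hg : StronglyMeasurable g) (hM : ∀ x, ‖g x‖ ≤ M) (hgK : ∀ x, g x ∈ K) (i : Fin m) :
    ⨍ y in cell m i, g y ∈ K :=
  hK.set_average_mem hKc (volume_cell_ne_zero i) (volume_cell_ne_top i) (.of_forall hgK)
    (Measure.integrableOn_of_bounded (volume_cell_ne_top i) hg.aestronglyMeasurable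
      (.of_forall hM))

theorem average_cell_prod_mem_Icc {g : ℝ × ℝ → ℝ} (hg : Measurable g)
    (hgI : ∀ p, g p ∈ Icc (0 : ℝ) 1) (i j : Fin m) :
    ⨍ q in cell m i ×ˢ cell m j, g q ∈ Icc (0 : ℝ) 1 := by
  have htop : volume (cell m i ×ˢ cell m j) ≠ ⊤ := by
    rw [Measure.volume_eq_prod, Measure.prod_prod]
    exact ENNReal.mul_ne_top (volume_cell_ne_top i) (volume_cell_ne_top j)
  refine (convex_Icc 0 1).set_average_mem isClosed_Icc ?_ htop (.of_forall hgI)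
    (Measure.integrableOn_of_bounded (M := 1) htop hg.aestronglyMeasurable (.of_forall fun p => ?_))
  · rw [Measure.volume_eq_prod, Measure.prod_prod]
    exact mul_ne_zero (volume_cell_ne_zero i) (volume_cell_ne_zero j)
  · rw [Real.norm_of_nonneg (hgI p).1]
    exact (hgI p).2

variable {E : Type*} [NormedAddCommGroup E] [NormedSpace ℝ E] {S : Set E}

theorem exists_netGamesTendsto {W : ℝ → ℝ → ℝ} {U : ℝ → CGame S} (hG : IsGraphonGame S W U) :
    ∃ (m : ℕ → ℕ) (A : ∀ n, Fin (m n) → Fin (m n) → ℝ) (v : ∀ n, Fin (m n) → CGame S),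
      (∀ n, IsNetworkGame S (m n) (A n) (v n)) ∧ NetGamesTendsto S m A v W U := by
  have hI : MeasurableSet (Ioc (0 : ℝ) 1 ×ˢ Ioc (0 : ℝ) 1) :=
    measurableSet_Ioc.prod measurableSet_Ioc
  set g : ℝ × ℝ → ℝ := (Ioc (0 : ℝ) 1 ×ˢ Ioc (0 : ℝ) 1).indicator (Function.uncurry W)
  have hg : Measurable g := hG.1.indicator hI
  have hgI : ∀ p, g p ∈ Icc (0 : ℝ) 1 := fun p => by
    by_cases hp : p ∈ Ioc (0 : ℝ) 1 ×ˢ Ioc (0 : ℝ) 1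
    · simp only [g, indicator_of_mem hp]
      exact hG.2.1 _ hp.1 _ hp.2
    · simp [g, indicator_of_notMem hp]
  refine ⟨fun n => n + 1, fun n i j => ⨍ q in cell (n + 1) i ×ˢ cell (n + 1) j, g q,
    fun n i => ⨍ y in cell (n + 1) i, U y, fun n => ⟨n.succ_pos,
      fun i j => average_cell_prod_mem_Icc hg hgI i j, fun i => ?_⟩, ?_, ?_, tendsto_add_atTop_nat 1⟩
  · rw [← mem_closedBall_zero_iff]
    exact average_cell_mem (convex_closedBall _ _) Metric.isClosed_closedBall hG.2.2.1 hG.2.2.2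
      (fun t => mem_closedBall_zero_iff.2 (hG.2.2.2 t)) i
  · have hgint : LocallyIntegrable g volume := locallyIntegrable_of_norm_le (M := 1)
      hg.stronglyMeasurable fun p => by
        rw [Real.norm_of_nonneg (hgI p).1]
        exact (hgI p).2
    filter_upwards [ae_tendsto_stepGraphonOf_average hgint (fun n => n.succ_pos)
      (tendsto_add_atTop_nat 1), ae_restrict_mem hI] with p hlim hp
    have hgp : g p = W p.1 p.2 := indicator_of_mem hp _
    rw [hgp] at hlim
    exact hlim
  · exact ae_tendsto_stepOf_average (locallyIntegrable_of_norm_le hG.2.2.1 hG.2.2.2)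
      (fun n => n.succ_pos) (tendsto_add_atTop_nat 1) 0

theorem exists_stepProfileOf_tendsto [CompleteSpace E] (hSconv : Convex ℝ S)
    (hScomp : IsCompact (weakS S)) {f : ℝ → E} (hf : IsProfile S f) {m : ℕ → ℕ}
    (hm0 : ∀ n, 0 < m n) (hm : Tendsto m atTop atTop) :
    ∃ s : ∀ n, Fin (m n) → E, (∀ n i, s n i ∈ S) ∧
      ∀ᵐ t ∂μ01, Tendsto (fun n => stepProfileOf (m n) (s n) t) atTop (𝓝 (f t)) := by
  obtain ⟨M, hM⟩ := exists_norm_le_of_isCompact_weakS hScomp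
  have hfM : ∀ t, ‖f t‖ ≤ M := fun t => hM _ (hf.2 t)
  exact ⟨fun n i => ⨍ y in cell (m n) i, f y,
    fun n i => average_cell_mem hSconv (isClosed_of_isCompact_weakS hScomp) hf.1 hfM hf.2 i,
    ae_tendsto_stepOf_average (locallyIntegrable_of_norm_le hf.1 hfM) hm0 hm 0⟩

end Averages

/-- **Characterization of Nash equilibria of graphon games** (Theorem 4 of the paper).
A strategy profile `f` of a graphon game `(W, U)` is a Nash equilibrium iff it is the
a.e. limit of asymptotic Nash equilibria of some sequence of network games converging
to `(W, U)`, iff every sequence of network games converging to `(W, U)` carries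
asymptotic Nash equilibria converging a.e. to `f`. -/
theorem nash_characterization
    {E : Type*} [NormedAddCommGroup E] [NormedSpace ℝ E] [CompleteSpace E]
    [TopologicalSpace.SeparableSpace E]
    (S : Set E) (hS0 : (0 : E) ∈ S) (hSconv : Convex ℝ S) (hScomp : IsCompact (weakS S))
    (W : ℝ → ℝ → ℝ) (U : ℝ → CGame S) (hG : IsGraphonGame S W U)
    (f : ℝ → E) (hf : IsProfile S f) :
    -- (1) ↔ (2)
    (IsNashEq S W U f ↔
      ∃ (m : ℕ → ℕ) (A : ∀ n, Fin (m n) → Fin (m n) → ℝ) (v : ∀ n, Fin (m n) → CGame S)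
        (s : ∀ n, Fin (m n) → E) (ε : ℕ → ℝ),
        (∀ n, IsNetworkGame S (m n) (A n) (v n)) ∧ (∀ n i, s n i ∈ S) ∧
        (∀ n, 0 ≤ ε n) ∧ (∀ n, IsNetEpsNashEq S (m n) (A n) (v n) (s n) (ε n)) ∧
        NetGamesTendsto S m A v W U ∧
        (∀ᵐ t ∂μ01, Tendsto (fun n => stepProfileOf (m n) (s n) t) atTop (𝓝 (f t))) ∧
        Tendsto ε atTop (𝓝 0)) ∧
    -- (1) ↔ (3)
    (IsNashEq S W U f ↔
      ∀ (m : ℕ → ℕ) (A : ∀ n, Fin (m n) → Fin (m n) → ℝ) (v : ∀ n, Fin (m n) → CGame S),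
        (∀ n, IsNetworkGame S (m n) (A n) (v n)) → NetGamesTendsto S m A v W U →
        ∃ (s : ∀ n, Fin (m n) → E) (ε : ℕ → ℝ),
          (∀ n i, s n i ∈ S) ∧ (∀ n, 0 ≤ ε n) ∧
          (∀ n, IsNetEpsNashEq S (m n) (A n) (v n) (s n) (ε n)) ∧
          (∀ᵐ t ∂μ01, Tendsto (fun n => stepProfileOf (m n) (s n) t) atTop (𝓝 (f t))) ∧
          Tendsto ε atTop (𝓝 0)) := by
  have exists_of_nash : IsNashEq S W U f →
      ∀ (m : ℕ → ℕ) (A : ∀ n, Fin (m n) → Fin (m n) → ℝ) (v : ∀ n, Fin (m n) → CGame S),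
        (∀ n, IsNetworkGame S (m n) (A n) (v n)) → NetGamesTendsto S m A v W U →
        ∃ (s : ∀ n, Fin (m n) → E) (ε : ℕ → ℝ),
          (∀ n i, s n i ∈ S) ∧ (∀ n, 0 ≤ ε n) ∧
          (∀ n, IsNetEpsNashEq S (m n) (A n) (v n) (s n) (ε n)) ∧
          (∀ᵐ t ∂μ01, Tendsto (fun n => stepProfileOf (m n) (s n) t) atTop (𝓝 (f t))) ∧
          Tendsto ε atTop (𝓝 0) := by
    intro hNash m A v hN hlim
    obtain ⟨s, hs, hsf⟩ :=
      exists_stepProfileOf_tendsto hSconv hScomp hf (fun n => (hN n).1) hlim.2.2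
    obtain ⟨ε, hε, hεN, hε0⟩ := (isNashEq_iff_exists_isNetEpsNashEq hS0 hSconv hScomp hG hf hN hs
      hlim hsf).1 hNash
    exact ⟨s, ε, hs, hε, hεN, hsf, hε0⟩
  obtain ⟨m₀, A₀, v₀, hN₀, hlim₀⟩ := exists_netGamesTendsto hG
  refine ⟨⟨fun hNash => ?_, ?_⟩, exists_of_nash, fun h => ?_⟩
  · obtain ⟨s, ε, hs, hε, hεN, hsf, hε0⟩ := exists_of_nash hNash m₀ A₀ v₀ hN₀ hlim₀
    exact ⟨m₀, A₀, v₀, s, ε, hN₀, hs, hε, hεN, hlim₀, hsf, hε0⟩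
  · rintro ⟨m, A, v, s, ε, hN, hs, hε, hεN, hlim, hsf, hε0⟩
    exact (isNashEq_iff_exists_isNetEpsNashEq hS0 hSconv hScomp hG hf hN hs hlim hsf).2
      ⟨ε, hε, hεN, hε0⟩
  · obtain ⟨s, ε, hs, hε, hεN, hsf, hε0⟩ := h m₀ A₀ v₀ hN₀ hlim₀
    exact (isNashEq_iff_exists_isNetEpsNashEq hS0 hSconv hScomp hG hf hN₀ hs hlim₀ hsf).2
      ⟨ε, hε, hεN, hε0⟩
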